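/- Let M ≥ 2 and Kc ≥ 0 be integers, λ > 0, and y = (y₀, y₁, …, y_{Kc}) ∈ ℝ × ℂ^{Kc}. Consider the quadratic objective J(w,a) := ½(|y₀ − a|² + Σ_{k=1}^{Kc} |y_k − ŵ[k]/(ik)^M|²) + λ‖w‖_M over pairs (w,a) with w ∈ M(𝕋) of zero mean and a ∈ ℝ, and let (w*, a*) be its unique minimizer. For each integer P ≥ 1, let (w_P, a_P) be any minimizer of J over the grid-restricted class of pairs (w,a) with w = Σ_{p=0}^{P−1} c_p δ_{2πp/P}, c ∈ ℝ^P, Σ_p c_p = 0, and a ∈ ℝ (such minimizers exist). Define the associated functions f_{w,a}(x) := a + (g_M ⊛ w)(x). Then sup_{x ∈ 𝕋} |f_{w_P, a_P}(x) − f_{w*, a*}(x)| → 0 as P → ∞; that is, the solutions of the grid-discretized problems converge uniformly on 𝕋 to the unique solution of the continuous-domain problem. -/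

import Mathlib

open MeasureTheory Filter
open scoped ENNReal Real

noncomputable section

instance fact2pi : Fact (0 < 2 * Real.pi) := ⟨by positivity⟩

/-- The circle `𝕋 = ℝ/(2πℤ)`. -/
abbrev Circle2pi : Type := AddCircle (2 * Real.pi)

/-- Integral of a real function against a finite real signed (Radon) measure on `𝕋`. -/
noncomputable def sIntR (w : SignedMeasure Circle2pi) (f : Circle2pi → ℝ) : ℝ :=
  (∫ x, f x ∂w.toJordanDecomposition.posPart) - ∫ x, f x ∂w.toJordanDecomposition.negPart

/-- Integral of a complex function against a signed measure on `𝕋`. -/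
noncomputable def sIntC (w : SignedMeasure Circle2pi) (f : Circle2pi → ℂ) : ℂ :=
  (∫ x, f x ∂w.toJordanDecomposition.posPart) - ∫ x, f x ∂w.toJordanDecomposition.negPart

/-- Total-variation norm `‖w‖_M` of a signed measure on `𝕋`. -/
noncomputable def tvNorm (w : SignedMeasure Circle2pi) : ℝ :=
  (w.totalVariation Set.univ).toReal

/-- The `k`-th Fourier coefficient `ŵ[k] = ∫_𝕋 e^{-ikx} dw(x)` of a signed measure. -/
noncomputable def fCoeff (w : SignedMeasure Circle2pi) (k : ℤ) : ℂ :=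
  sIntC w fun x => fourier (-k) x

/-- The Dirac measure `δ_x` as a signed measure. -/
noncomputable def diracSM (x : Circle2pi) : SignedMeasure Circle2pi :=
  (MeasureTheory.Measure.dirac x).toSignedMeasure

/-- The quadratic objective
`J(w,a) = ½(|y₀-a|² + Σ_{k=1}^{Kc} |y_k - ŵ[k]/(ik)^M|²) + λ‖w‖_M`. -/
noncomputable def quadJ (M Kc : ℕ) (y0 : ℝ) (yr : Fin Kc → ℂ) (lam : ℝ)
    (w : SignedMeasure Circle2pi) (a : ℝ) : ℝ :=
  (1 / 2) * ((y0 - a) ^ 2 +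
      ∑ k : Fin Kc,
        ‖yr k - fCoeff w ((k.1 : ℤ) + 1) / (Complex.I * ((k.1 + 1 : ℕ) : ℂ)) ^ M‖ ^ 2)
    + lam * tvNorm w

/-- The periodic Green's function `g_M(x) = Σ_{k≠0} e^{ikx}/(ik)^M` of `D^M` (complex form). -/
noncomputable def greenC (M : ℕ) (x : Circle2pi) : ℂ :=
  ∑' k : ℤ, if k = 0 then 0 else fourier k x / (Complex.I * (k : ℂ)) ^ M

/-- The (real-valued) periodic Green's function of `D^M`. -/
noncomputable def greenR (M : ℕ) (x : Circle2pi) : ℝ := (greenC M x).re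

/-- The convolution `(g_M ⊛ w)(x) = ∫_𝕋 g_M(x-t) dw(t)`. -/
noncomputable def greenConv (M : ℕ) (w : SignedMeasure Circle2pi) (x : Circle2pi) : ℝ :=
  sIntR w fun t => greenR M (x - t)

/-- The grid point `2πp/P ∈ 𝕋`. -/
noncomputable def gridPt (P : ℕ) (p : Fin P) : Circle2pi :=
  ((2 * Real.pi * (p.1 : ℝ) / (P : ℝ) : ℝ) : Circle2pi)

/-- The grid-restricted class: `w = Σ_{p=0}^{P-1} c_p δ_{2πp/P}` with `Σ_p c_p = 0`. -/
def IsGridMeasure (P : ℕ) (w : SignedMeasure Circle2pi) : Prop :=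
  ∃ c : Fin P → ℝ, (∑ p, c p) = 0 ∧ w = ∑ p, c p • diracSM (gridPt P p)

end

open scoped NNReal Topology

section Helpers

lemma hp_decomp (w : SignedMeasure Circle2pi) :
    w = w.toJordanDecomposition.posPart.toSignedMeasure
      - w.toJordanDecomposition.negPart.toSignedMeasure :=
  (SignedMeasure.toSignedMeasure_toJordanDecomposition w).symm

lemma hp_intg {E : Type*} [NormedAddCommGroup E] {f : Circle2pi → E}
    (hf : Continuous f) (μ : Measure Circle2pi) [IsFiniteMeasure μ] : Integrable f μ := by
  exact hf.integrable_of_hasCompactSupport (HasCompactSupport.of_compactSpace f)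

lemma hp_int_eq {E : Type*} [NormedAddCommGroup E] [NormedSpace ℝ E]
    {f : Circle2pi → E} (hf : Continuous f) (w : SignedMeasure Circle2pi)
    (μ ν : Measure Circle2pi) [IsFiniteMeasure μ] [IsFiniteMeasure ν]
    (hw : w = μ.toSignedMeasure - ν.toSignedMeasure) :
    (∫ x, f x ∂w.toJordanDecomposition.posPart) - ∫ x, f x ∂w.toJordanDecomposition.negPart
      = (∫ x, f x ∂μ) - ∫ x, f x ∂ν := by
  have h1 := hp_decomp w
  set p := w.toJordanDecomposition.posPart
  set n := w.toJordanDecomposition.negPart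
  have h2 : (p + ν).toSignedMeasure = (μ + n).toSignedMeasure := by
    rw [Measure.toSignedMeasure_add, Measure.toSignedMeasure_add]
    have : p.toSignedMeasure - n.toSignedMeasure = μ.toSignedMeasure - ν.toSignedMeasure := by
      rw [← h1, ← hw]
    rw [sub_eq_sub_iff_add_eq_add] at this
    exact this
  have h3 : p + ν = μ + n := (Measure.toSignedMeasure_eq_toSignedMeasure_iff).1 h2
  have h4 : ∫ x, f x ∂(p + ν) = ∫ x, f x ∂(μ + n) := by rw [h3]
  rw [integral_add_measure (hp_intg hf _) (hp_intg hf _),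
    integral_add_measure (hp_intg hf _) (hp_intg hf _)] at h4
  rw [sub_eq_sub_iff_add_eq_add]
  exact h4

lemma hp_tv_eq (w : SignedMeasure Circle2pi) :
    tvNorm w = w.toJordanDecomposition.posPart.real Set.univ
      + w.toJordanDecomposition.negPart.real Set.univ := by
  unfold tvNorm SignedMeasure.totalVariation
  rw [Measure.add_apply, ENNReal.toReal_add (measure_ne_top _ _) (measure_ne_top _ _)]
  rfl

lemma hp_tv_nonneg (w : SignedMeasure Circle2pi) : 0 ≤ tvNorm w := ENNReal.toReal_nonneg

lemma hp_tv_le (w : SignedMeasure Circle2pi)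
    (μ ν : Measure Circle2pi) [IsFiniteMeasure μ] [IsFiniteMeasure ν]
    (hw : w = μ.toSignedMeasure - ν.toSignedMeasure) :
    tvNorm w ≤ μ.real Set.univ + ν.real Set.univ := by
  rw [hp_tv_eq]
  obtain ⟨s, hs, h1, h2⟩ := w.toJordanDecomposition.mutuallySingular
  have h3 : ∀ i, MeasurableSet i → w.toJordanDecomposition.posPart.real i
      - w.toJordanDecomposition.negPart.real i = μ.real i - ν.real i := by
    intro i hi
    rw [← Measure.toSignedMeasure_sub_apply (μ := μ) hi, ← hw,
      ← Measure.toSignedMeasure_sub_apply hi, ← hp_decomp w]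
  set p := w.toJordanDecomposition.posPart
  set n := w.toJordanDecomposition.negPart
  have a1 := h3 s hs
  have a2 := h3 sᶜ hs.compl
  have e1 : p.real s = 0 := by simp [Measure.real, h1]
  have e2 : n.real sᶜ = 0 := by simp [Measure.real, h2]
  rw [← measureReal_add_measureReal_compl (μ := p) hs, ← measureReal_add_measureReal_compl (μ := n) hs,
    ← measureReal_add_measureReal_compl (μ := μ) hs, ← measureReal_add_measureReal_compl (μ := ν) hs]
  have := measureReal_nonneg (μ := μ) (s := s)
  have := measureReal_nonneg (μ := ν) (s := sᶜ)
  linarith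

lemma hp_lin_decomp (w h : SignedMeasure Circle2pi) (s t : ℝ≥0) :
    (s : ℝ) • w + (t : ℝ) • h =
      (s • w.toJordanDecomposition.posPart + t • h.toJordanDecomposition.posPart).toSignedMeasure
      - (s • w.toJordanDecomposition.negPart
        + t • h.toJordanDecomposition.negPart).toSignedMeasure := by
  rw [Measure.toSignedMeasure_add, Measure.toSignedMeasure_add, Measure.toSignedMeasure_smul,
    Measure.toSignedMeasure_smul, Measure.toSignedMeasure_smul, Measure.toSignedMeasure_smul]
  conv_lhs => rw [hp_decomp w, hp_decomp h]
  ext i hi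
  simp [NNReal.smul_def, hi]
  ring

lemma hp_lin_tv (w h : SignedMeasure Circle2pi) (s t : ℝ≥0) :
    tvNorm ((s : ℝ) • w + (t : ℝ) • h) ≤ s * tvNorm w + t * tvNorm h := by
  refine (hp_tv_le _ _ _ (hp_lin_decomp w h s t)).trans_eq ?_
  rw [hp_tv_eq, hp_tv_eq]
  rw [measureReal_add_apply, measureReal_add_apply]
  simp only [measureReal_nnreal_smul_apply]
  ring

lemma hp_lin_intC (w h : SignedMeasure Circle2pi) (s t : ℝ≥0) {f : Circle2pi → ℂ}
    (hf : Continuous f) :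
    sIntC ((s : ℝ) • w + (t : ℝ) • h) f = s * sIntC w f + t * sIntC h f := by
  unfold sIntC
  rw [hp_int_eq hf _ _ _ (hp_lin_decomp w h s t)]
  rw [integral_add_measure (hp_intg hf _) (hp_intg hf _),
    integral_add_measure (hp_intg hf _) (hp_intg hf _)]
  rw [integral_smul_nnreal_measure, integral_smul_nnreal_measure, integral_smul_nnreal_measure,
    integral_smul_nnreal_measure]
  simp only [NNReal.smul_def, Complex.real_smul]
  ring

lemma hp_sIntC_add (w : SignedMeasure Circle2pi) {f g : Circle2pi → ℂ}
    (hf : Continuous f) (hg : Continuous g) :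
    sIntC w (fun x => f x + g x) = sIntC w f + sIntC w g := by
  unfold sIntC
  rw [integral_add (hp_intg hf _) (hp_intg hg _), integral_add (hp_intg hf _) (hp_intg hg _)]
  ring

lemma hp_sIntC_mul (w : SignedMeasure Circle2pi) (f : Circle2pi → ℂ) (c : ℂ) :
    sIntC w (fun x => c * f x) = c * sIntC w f := by
  unfold sIntC
  rw [integral_const_mul, integral_const_mul]
  ring

lemma hp_sIntC_sum (w : SignedMeasure Circle2pi) {ι : Type*} (s : Finset ι)
    (f : ι → Circle2pi → ℂ) (hf : ∀ i ∈ s, Continuous (f i)) :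
    sIntC w (fun x => ∑ i ∈ s, f i x) = ∑ i ∈ s, sIntC w (f i) := by
  unfold sIntC
  rw [integral_finsetSum _ (fun i hi => hp_intg (hf i hi) _),
    integral_finsetSum _ (fun i hi => hp_intg (hf i hi) _), Finset.sum_sub_distrib]

lemma hp_re (w : SignedMeasure Circle2pi) {f : Circle2pi → ℂ} (hf : Continuous f) :
    (sIntC w f).re = sIntR w (fun x => (f x).re) := by
  unfold sIntC sIntR
  have h1 := integral_re (𝕜 := ℂ) (hp_intg hf w.toJordanDecomposition.posPart)
  have h2 := integral_re (𝕜 := ℂ) (hp_intg hf w.toJordanDecomposition.negPart)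
  simp only [RCLike.re_eq_complex_re] at h1 h2
  rw [Complex.sub_re, h1, h2]

lemma hp_fc_zero (w : SignedMeasure Circle2pi) (hw : w Set.univ = 0) : fCoeff w 0 = 0 := by
  have h := hp_decomp w
  have h3 : w.toJordanDecomposition.posPart.real Set.univ
      - w.toJordanDecomposition.negPart.real Set.univ = 0 := by
    rw [← Measure.toSignedMeasure_sub_apply MeasurableSet.univ, ← hp_decomp w, hw]
  unfold fCoeff sIntC
  simp only [neg_zero, fourier_zero, integral_const]
  rw [sub_eq_zero] at h3 ⊢
  rw [h3]

lemma hp_fc_neg (w : SignedMeasure Circle2pi) (k : ℤ) :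
    fCoeff w (-k) = (starRingEnd ℂ) (fCoeff w k) := by
  unfold fCoeff sIntC
  rw [map_sub, ← integral_conj, ← integral_conj]
  simp only [neg_neg, fourier_neg, Complex.conj_conj]

lemma hp_norm_le (w : SignedMeasure Circle2pi) {h : Circle2pi → ℂ}
    {η : Circle2pi → ℝ} (hη : Continuous η) (lam ε C : ℝ) (hC : 0 ≤ C)
    (hb : ∀ x, ‖h x‖ ≤ ε + C * (lam - |η x|)) :
    ‖sIntC w h‖ ≤ ε * tvNorm w + C * (lam * tvNorm w - sIntR w η) := by
  unfold sIntC sIntR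
  rw [hp_tv_eq]
  set p := w.toJordanDecomposition.posPart
  set n := w.toJordanDecomposition.negPart
  have key : ∀ (μ : Measure Circle2pi) [IsFiniteMeasure μ] (s : ℝ), |s| = 1 →
      ‖∫ x, h x ∂μ‖ ≤ ε * μ.real Set.univ + C * (lam * μ.real Set.univ - s * ∫ x, η x ∂μ) := by
    intro μ _ s hs
    have h1 : ∫ x, (ε + C * (lam - s * η x)) ∂μ =
        ε * μ.real Set.univ + C * (lam * μ.real Set.univ - s * ∫ x, η x ∂μ) := by
      rw [integral_add (hp_intg (by fun_prop) _) (hp_intg (by fun_prop) _), integral_const_mul,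
        integral_sub (hp_intg (by fun_prop) _) (hp_intg (by fun_prop) _), integral_const_mul]
      simp
      ring
    rw [← h1]
    refine norm_integral_le_of_norm_le (hp_intg (by fun_prop) _) (Eventually.of_forall fun x => ?_)
    refine (hb x).trans ?_
    have : s * η x ≤ |η x| := by
      calc s * η x ≤ |s * η x| := le_abs_self _
        _ = |η x| := by rw [abs_mul, hs, one_mul]
    gcongr
  have k1 := key p 1 (by simp)
  have k2 := key n (-1) (by simp)
  refine (norm_sub_le _ _).trans ?_
  linarith

end Helpers

section Interp

open Polynomial

lemma hp_fourier_zpow (n : ℤ) (x : Circle2pi) :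
    fourier n x = ((AddCircle.toCircle x : Circle) : ℂ) ^ n := by
  rw [fourier_apply, AddCircle.toCircle_zsmul, Circle.coe_zpow]

lemma hp_tc_inj : Function.Injective
    (fun x : Circle2pi => ((AddCircle.toCircle x : Circle) : ℂ)) := by
  intro x y h
  exact AddCircle.injective_toCircle (fact2pi.out.ne') (Subtype.coe_injective h)

lemma hp_deriv {Kc : ℕ} (d : Fin Kc → ℂ) (t : ℝ) :
    HasDerivAt (fun t : ℝ => (∑ k : Fin Kc, d k * fourier (-((k.1 : ℤ) + 1)) (t : Circle2pi)).re)
      ((∑ k : Fin Kc, ((k.1 : ℂ) + 1) *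
        (d k * fourier (-((k.1 : ℤ) + 1)) (t : Circle2pi))).im) t := by
  have h : HasDerivAt (fun t : ℝ => ∑ k : Fin Kc, d k * fourier (-((k.1 : ℤ) + 1)) (t : Circle2pi))
      (∑ k : Fin Kc, d k * (2 * π * Complex.I * ((-((k.1 : ℤ) + 1) : ℤ) : ℂ) / ((2 * π : ℝ) : ℂ)
        * fourier (-((k.1 : ℤ) + 1)) (t : Circle2pi))) t := by
    exact HasDerivAt.fun_sum (u := Finset.univ) (fun (k : Fin Kc) _ =>
      (hasDerivAt_fourier (2 * π) (-((k.1 : ℤ) + 1)) t).const_mul (d k))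
  have h2 := Complex.reCLM.hasFDerivAt.comp_hasDerivAt t h
  refine HasDerivAt.congr_deriv (f := fun t : ℝ => (∑ k : Fin Kc, d k *
    fourier (-((k.1 : ℤ) + 1)) (t : Circle2pi)).re) h2 ?_
  symm
  rw [Complex.reCLM_apply, Complex.re_sum, Complex.im_sum]
  refine Finset.sum_congr rfl fun k _ => ?_
  have hpi : ((2 * π : ℝ) : ℂ) ≠ 0 := by
    exact_mod_cast fact2pi.out.ne'
  have : d k * (2 * π * Complex.I * ((-((k.1 : ℤ) + 1) : ℤ) : ℂ) / ((2 * π : ℝ) : ℂ)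
        * fourier (-((k.1 : ℤ) + 1)) (t : Circle2pi)) =
        -(Complex.I * (((k.1 : ℂ) + 1) * (d k * fourier (-((k.1 : ℤ) + 1)) (t : Circle2pi)))) := by
    push_cast at hpi ⊢
    field_simp
  rw [this, Complex.neg_re, Complex.I_mul_re, neg_neg]

/-- Polynomial whose roots contain the critical points. -/
noncomputable def hpPoly {Kc : ℕ} (d : Fin Kc → ℂ) : ℂ[X] :=
  ∑ k : Fin Kc, (C (((k.1 : ℂ) + 1) * (starRingEnd ℂ) (d k)) * X ^ (Kc + k.1 + 1)
    - C (((k.1 : ℂ) + 1) * d k) * X ^ (Kc - (k.1 + 1)))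

lemma hp_poly_deg {Kc : ℕ} (d : Fin Kc → ℂ) : (hpPoly d).natDegree ≤ 2 * Kc := by
  unfold hpPoly
  refine natDegree_sum_le_of_forall_le _ _ fun k _ => ?_
  refine (natDegree_sub_le _ _).trans (max_le ?_ ?_)
  · exact (natDegree_C_mul_X_pow_le _ _).trans (by omega)
  · exact (natDegree_C_mul_X_pow_le _ _).trans (by omega)

lemma hp_poly_zero {Kc : ℕ} (d : Fin Kc → ℂ) (h : hpPoly d = 0) (k : Fin Kc) : d k = 0 := by
  have h1 : (hpPoly d).coeff (Kc + k.1 + 1) = ((k.1 : ℂ) + 1) * (starRingEnd ℂ) (d k) := by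
    unfold hpPoly
    rw [finsetSum_coeff, Finset.sum_eq_single k]
    · rw [coeff_sub, coeff_C_mul_X_pow, coeff_C_mul_X_pow, if_pos rfl, if_neg (by omega), sub_zero]
    · intro b _ hb
      have : b.1 ≠ k.1 := fun h => hb (Fin.ext h)
      rw [coeff_sub, coeff_C_mul_X_pow, coeff_C_mul_X_pow, if_neg (by omega), if_neg (by omega),
        sub_zero]
    · simp
  rw [h, coeff_zero] at h1
  have h2 : ((k.1 : ℂ) + 1) ≠ 0 := by exact_mod_cast Nat.succ_ne_zero k.1
  have h3 := (mul_eq_zero.1 h1.symm).resolve_left h2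
  simpa using h3

lemma hp_poly_eval {Kc : ℕ} (d : Fin Kc → ℂ) (x : Circle2pi)
    (h : (∑ k : Fin Kc, ((k.1 : ℂ) + 1) * (d k * fourier (-((k.1 : ℤ) + 1)) x)).im = 0) :
    (hpPoly d).eval ((AddCircle.toCircle x : Circle) : ℂ) = 0 := by
  set u := ∑ k : Fin Kc, ((k.1 : ℂ) + 1) * (d k * fourier (-((k.1 : ℤ) + 1)) x) with hu
  have hz : ((AddCircle.toCircle x : Circle) : ℂ) ≠ 0 := Circle.coe_ne_zero _
  have h1 : (hpPoly d).eval ((AddCircle.toCircle x : Circle) : ℂ)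
      = ((AddCircle.toCircle x : Circle) : ℂ) ^ Kc * ((starRingEnd ℂ) u - u) := by
    rw [hu, map_sum, ← Finset.sum_sub_distrib, Finset.mul_sum]
    unfold hpPoly
    rw [eval_finsetSum]
    refine Finset.sum_congr rfl fun k _ => ?_
    have e1 : (starRingEnd ℂ) (fourier (-((k.1 : ℤ) + 1)) x)
        = ((AddCircle.toCircle x : Circle) : ℂ) ^ (k.1 + 1) := by
      rw [← fourier_neg, neg_neg, hp_fourier_zpow]
      exact_mod_cast rfl
    have e2 : ((AddCircle.toCircle x : Circle) : ℂ) ^ Kc * fourier (-((k.1 : ℤ) + 1)) x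
        = ((AddCircle.toCircle x : Circle) : ℂ) ^ (Kc - (k.1 + 1)) := by
      rw [hp_fourier_zpow, ← zpow_natCast, ← zpow_natCast, ← zpow_add₀ hz]
      congr 1
      have := k.2
      omega
    simp only [eval_sub, eval_mul, eval_C, eval_pow, eval_X]
    simp only [map_mul, e1, map_add, map_one, map_natCast]
    rw [← e2]
    ring
  rw [h1, Complex.conj_eq_iff_im.2 h]
  simp

lemma hp_finite {Kc : ℕ} (d : Fin Kc → ℂ) (ψ : Circle2pi → ℝ)
    (hψ : ψ = fun x => (∑ k : Fin Kc, d k * fourier (-((k.1 : ℤ) + 1)) x).re)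
    (x1 x2 : Circle2pi) (lam : ℝ) (hlam : 0 < lam)
    (hb : ∀ x, |ψ x - (ψ x1 + ψ x2) / 2| ≤ lam) :
    ∃ S : Finset Circle2pi, S.card ≤ 2 * Kc ∧
      ∀ x, |ψ x - (ψ x1 + ψ x2) / 2| = lam → x ∈ S := by
  classical
  by_cases hQ : hpPoly d = 0
  · refine ⟨∅, by simp, fun x hx => ?_⟩
    have hd := hp_poly_zero d hQ
    simp [hψ, hd] at hx
    exact absurd hx hlam.ne
  · refine ⟨(hpPoly d).roots.toFinset.preimage _ hp_tc_inj.injOn, ?_, ?_⟩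
    · refine (Finset.card_le_card_of_injOn _ (t := (hpPoly d).roots.toFinset) ?_
        hp_tc_inj.injOn).trans ?_
      · intro x hx
        simpa using hx
      · exact (Multiset.toFinset_card_le _).trans ((card_roots' _).trans (hp_poly_deg d))
    · intro x hx
      rw [Finset.mem_preimage, Multiset.mem_toFinset, mem_roots hQ]
      apply hp_poly_eval
      induction x using QuotientAddGroup.induction_on with
      | H t =>
      have hd := hp_deriv d t
      have hext : IsLocalExtr (fun t : ℝ => (∑ k : Fin Kc, d k *
          fourier (-((k.1 : ℤ) + 1)) (t : Circle2pi)).re) t := by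
        have e : (fun t : ℝ => (∑ k : Fin Kc, d k *
          fourier (-((k.1 : ℤ) + 1)) (t : Circle2pi)).re) = fun t : ℝ => ψ t := by rw [hψ]
        rw [e]
        rcases abs_eq hlam.le |>.1 hx with h | h
        · right
          refine Eventually.of_forall fun s => ?_
          have := (abs_le.1 (hb s)).2
          change ψ s ≤ ψ t
          linarith
        · left
          refine Eventually.of_forall fun s => ?_
          have := (abs_le.1 (hb s)).1
          change ψ t ≤ ψ s
          linarith
      exact hext.hasDerivAt_eq_zero hd

lemma hp_interp (Kc : ℕ) (S : Finset Circle2pi) (hS : S.card ≤ 2 * Kc) (f : Circle2pi → ℂ) :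
    ∃ b : ℕ → ℂ, ∀ x ∈ S,
      f x = ∑ j ∈ Finset.range (2 * Kc + 1), b j * fourier ((j : ℤ) - Kc) x := by
  classical
  set v : Circle2pi → ℂ := fun x => ((AddCircle.toCircle x : Circle) : ℂ) with hv
  set p := Lagrange.interpolate S v (fun x => f x * v x ^ Kc) with hp
  have hdeg : p.degree < S.card := Lagrange.degree_interpolate_lt _ hp_tc_inj.injOn
  refine ⟨p.coeff, fun x hx => ?_⟩
  have hz : v x ≠ 0 := Circle.coe_ne_zero _
  have h1 : p.eval (v x) = f x * v x ^ Kc :=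
    Lagrange.eval_interpolate_at_node _ hp_tc_inj.injOn hx
  have h2 : p.natDegree < 2 * Kc + 1 := by
    have := natDegree_le_of_degree_le (hdeg.le.trans (by exact_mod_cast hS : _ ≤ ((2 * Kc : ℕ) : WithBot ℕ)))
    omega
  rw [eval_eq_sum_range' h2] at h1
  have h3 : f x = v x ^ (-(Kc : ℤ)) * (f x * v x ^ Kc) := by
    rw [zpow_neg, zpow_natCast]
    field_simp
  rw [h3, ← h1, Finset.mul_sum]
  refine Finset.sum_congr rfl fun j _ => ?_
  rw [hp_fourier_zpow, sub_eq_add_neg, zpow_add₀ hz, zpow_natCast]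
  ring

lemma hp_bound (h : Circle2pi → ℂ) (hh : Continuous h) (η : Circle2pi → ℝ) (hη : Continuous η)
    (lam : ℝ) (hb : ∀ x, |η x| ≤ lam) (hv : ∀ x, |η x| = lam → h x = 0) (ε : ℝ) (hε : 0 < ε) :
    ∃ C : ℝ, 0 ≤ C ∧ ∀ x, ‖h x‖ ≤ ε + C * (lam - |η x|) := by
  obtain ⟨B, hB⟩ := (isCompact_univ (X := Circle2pi)).exists_bound_of_continuousOn hh.continuousOn
  have hB0 : 0 ≤ B := (norm_nonneg _).trans (hB 0 trivial)
  by_cases hne : ({x | ε ≤ ‖h x‖} : Set Circle2pi).Nonempty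
  · have hc : IsCompact ({x | ε ≤ ‖h x‖} : Set Circle2pi) :=
      (isClosed_le continuous_const hh.norm).isCompact
    obtain ⟨x0, hx0, hmin⟩ := hc.exists_isMinOn hne
      (f := fun x => lam - |η x|) (by fun_prop)
    have hm : 0 < lam - |η x0| := by
      rcases (hb x0).lt_or_eq with h1 | h1
      · linarith
      · have := hv x0 h1
        simp only [Set.mem_ofPred_eq, this, norm_zero] at hx0
        linarith
    refine ⟨B / (lam - |η x0|), by positivity, fun x => ?_⟩
    by_cases hx : ε ≤ ‖h x‖
    · have h1 : lam - |η x0| ≤ lam - |η x| := hmin hx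
      have h2 : B ≤ B / (lam - |η x0|) * (lam - |η x|) := by
        rw [div_mul_eq_mul_div, le_div_iff₀ hm]
        gcongr
      have := hB x trivial
      linarith
    · have : 0 ≤ B / (lam - |η x0|) * (lam - |η x|) :=
        mul_nonneg (by positivity) (by linarith [hb x])
      linarith
  · refine ⟨0, le_rfl, fun x => ?_⟩
    have : ¬ ε ≤ ‖h x‖ := fun h => hne ⟨x, h⟩
    linarith

end Interp

section GridGreen

/-- Fractional coordinate in `[0,1)`. -/
noncomputable def hpU (x : Circle2pi) : ℝ :=
  ((AddCircle.measurableEquivIco (2 * π) 0 x : Set.Ico (0 : ℝ) (0 + 2 * π)) : ℝ) / (2 * π)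

lemma hpU_meas : Measurable hpU :=
  (measurable_subtype_coe.comp (AddCircle.measurableEquivIco (2 * π) 0).measurable).div_const _

lemma hpU_nonneg (x : Circle2pi) : 0 ≤ hpU x :=
  div_nonneg (AddCircle.measurableEquivIco (2 * π) 0 x).2.1 fact2pi.out.le

lemma hpU_lt (x : Circle2pi) : hpU x < 1 := by
  have := (AddCircle.measurableEquivIco (2 * π) 0 x).2.2
  exact (div_lt_one fact2pi.out).2 (this.trans_eq (zero_add _))

lemma hpU_coe (x : Circle2pi) : ((2 * π * hpU x : ℝ) : Circle2pi) = x := by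
  have : 2 * π * hpU x = (AddCircle.measurableEquivIco (2 * π) 0 x : Set.Ico (0 : ℝ) (0 + 2 * π)) := by
    unfold hpU
    have := fact2pi.out.ne'
    field_simp
  rw [this]
  exact (AddCircle.measurableEquivIco (2 * π) 0).symm_apply_apply x

/-- Rounding map. -/
noncomputable def hpPhi (P : ℕ) (x : Circle2pi) : Circle2pi :=
  ((2 * π * (⌊hpU x * P⌋₊ : ℝ) / (P : ℝ) : ℝ) : Circle2pi)

lemma hpIdx_meas (P : ℕ) : Measurable (fun x => ⌊hpU x * P⌋₊) :=
  Nat.measurable_floor.comp (hpU_meas.mul_const _)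

lemma hpPhi_meas (P : ℕ) : Measurable (hpPhi P) := by
  have h : Measurable (fun n : ℕ => ((2 * π * (n : ℝ) / (P : ℝ) : ℝ) : Circle2pi)) :=
    measurable_from_nat
  exact h.comp (hpIdx_meas P)

lemma hpPhi_tendsto (x : Circle2pi) : Tendsto (fun P => hpPhi P x) atTop (𝓝 x) := by
  have h1 := (tendsto_nat_floor_mul_div_atTop (hpU_nonneg x)).comp
    (tendsto_natCast_atTop_atTop (R := ℝ))
  have h2 := h1.const_mul (2 * π)
  have h3 := ((AddCircle.continuous_mk' (2 * π)).tendsto (2 * π * hpU x)).comp h2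
  have h4 : ((QuotientAddGroup.mk' (AddSubgroup.zmultiples (2 * π))) (2 * π * hpU x)) = x :=
    hpU_coe x
  rw [h4] at h3
  refine h3.congr fun P => ?_
  simp only [hpPhi, Function.comp_apply, mul_div_assoc]
  rfl

lemma hp_map_grid (P : ℕ) (hP : 1 ≤ P) (μ : Measure Circle2pi) [IsFiniteMeasure μ] :
    (μ.map (hpPhi P)).toSignedMeasure =
      ∑ p : Fin P, μ.real ((fun x => ⌊hpU x * P⌋₊) ⁻¹' {p.1}) • diracSM (gridPt P p) := by
  classical
  ext A hA
  rw [Measure.toSignedMeasure_apply_measurable hA,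
    map_measureReal_apply (hpPhi_meas P) hA]
  have h1 : μ.real (hpPhi P ⁻¹' A) = (μ.restrict (hpPhi P ⁻¹' A)).real
      ((fun x => ⌊hpU x * P⌋₊) ⁻¹' (Finset.range P : Set ℕ)) := by
    have : ((fun x => ⌊hpU x * P⌋₊) ⁻¹' (Finset.range P : Set ℕ)) = Set.univ := by
      ext x
      simp only [Set.mem_preimage, Finset.coe_range, Set.mem_Iio, Set.mem_univ, iff_true]
      rw [Nat.floor_lt (mul_nonneg (hpU_nonneg x) (Nat.cast_nonneg _))]
      have : (0 : ℝ) < P := by exact_mod_cast hP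
      nlinarith [hpU_lt x]
    rw [this, measureReal_restrict_apply MeasurableSet.univ, Set.univ_inter]
  rw [h1, ← sum_measureReal_preimage_singleton _
    (fun y _ => hpIdx_meas P (measurableSet_singleton y)), Finset.sum_range]
  have h2 : (∑ p : Fin P, μ.real ((fun x => ⌊hpU x * P⌋₊) ⁻¹' {p.1}) • diracSM (gridPt P p)) A
      = ∑ p : Fin P, μ.real ((fun x => ⌊hpU x * P⌋₊) ⁻¹' {p.1}) * (diracSM (gridPt P p)) A := by
    simp
  rw [h2]
  refine Finset.sum_congr rfl fun p _ => ?_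
  rw [measureReal_restrict_apply (hpIdx_meas P (measurableSet_singleton _)), diracSM,
    Measure.toSignedMeasure_apply_measurable hA]
  by_cases hp : gridPt P p ∈ A
  · have : (fun x => ⌊hpU x * P⌋₊) ⁻¹' {p.1} ∩ hpPhi P ⁻¹' A
        = (fun x => ⌊hpU x * P⌋₊) ⁻¹' {p.1} := by
      rw [Set.inter_eq_left]
      intro x hx
      simp only [Set.mem_preimage, Set.mem_singleton_iff] at hx ⊢
      unfold hpPhi
      rw [hx]
      exact hp
    rw [this]
    simp [Measure.real, hA, hp]
  · have : (fun x => ⌊hpU x * P⌋₊) ⁻¹' {p.1} ∩ hpPhi P ⁻¹' A = ∅ := by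
      rw [Set.eq_empty_iff_forall_notMem]
      rintro x ⟨hx, hx2⟩
      simp only [Set.mem_preimage, Set.mem_singleton_iff] at hx hx2
      unfold hpPhi at hx2
      rw [hx] at hx2
      exact hp hx2
    rw [this]
    simp [Measure.real, hA, hp]

lemma hp_map_tendsto (μ : Measure Circle2pi) [IsFiniteMeasure μ] {f : Circle2pi → ℂ}
    (hf : Continuous f) :
    Tendsto (fun P => ∫ x, f x ∂(μ.map (hpPhi P))) atTop (𝓝 (∫ x, f x ∂μ)) := by
  obtain ⟨B, hB⟩ := (isCompact_univ (X := Circle2pi)).exists_bound_of_continuousOn hf.continuousOn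
  have h1 : ∀ P, ∫ x, f x ∂(μ.map (hpPhi P)) = ∫ x, f (hpPhi P x) ∂μ := fun P =>
    integral_map (hpPhi_meas P).aemeasurable hf.aestronglyMeasurable
  simp_rw [h1]
  refine tendsto_integral_of_dominated_convergence (fun _ => B) (fun P => ?_)
    (integrable_const _) (fun P => Eventually.of_forall fun x => hB _ trivial)
    (Eventually.of_forall fun x => (hf.tendsto x).comp (hpPhi_tendsto x))
  exact (hf.measurable.comp (hpPhi_meas P)).aestronglyMeasurable

lemma hp_grid (w : SignedMeasure Circle2pi) (hw : w Set.univ = 0) :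
    ∃ v : ℕ → SignedMeasure Circle2pi,
      (∀ P, 1 ≤ P → IsGridMeasure P (v P)) ∧ (∀ P, tvNorm (v P) ≤ tvNorm w) ∧
      ∀ k, Tendsto (fun P => fCoeff (v P) k) atTop (𝓝 (fCoeff w k)) := by
  refine ⟨fun P => (w.toJordanDecomposition.posPart.map (hpPhi P)).toSignedMeasure
    - (w.toJordanDecomposition.negPart.map (hpPhi P)).toSignedMeasure, ?_, ?_, ?_⟩
  · intro P hP
    refine ⟨fun p => w.toJordanDecomposition.posPart.real ((fun x => ⌊hpU x * P⌋₊) ⁻¹' {p.1})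
      - w.toJordanDecomposition.negPart.real ((fun x => ⌊hpU x * P⌋₊) ⁻¹' {p.1}), ?_, ?_⟩
    · have key : ∀ (μ : Measure Circle2pi) [IsFiniteMeasure μ],
          ∑ p : Fin P, μ.real ((fun x => ⌊hpU x * P⌋₊) ⁻¹' {p.1}) = μ.real Set.univ := by
        intro μ _
        have h := congrArg (fun s => s Set.univ) (hp_map_grid P hP μ)
        simp only [Measure.toSignedMeasure_apply_measurable MeasurableSet.univ,
          map_measureReal_apply (hpPhi_meas P) MeasurableSet.univ, Set.preimage_univ] at h
        rw [h]
        simp [diracSM]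
      rw [Finset.sum_sub_distrib, key, key, ← Measure.toSignedMeasure_sub_apply MeasurableSet.univ,
        ← hp_decomp w, hw]
    · simp only [hp_map_grid P hP]
      ext A hA
      simp [sub_mul, Finset.sum_sub_distrib]
  · intro P
    refine (hp_tv_le _ _ _ rfl).trans_eq ?_
    rw [hp_tv_eq, map_measureReal_apply (hpPhi_meas P) MeasurableSet.univ,
      map_measureReal_apply (hpPhi_meas P) MeasurableSet.univ, Set.preimage_univ]
  · intro k
    unfold fCoeff sIntC
    have hc : Continuous (fun x : Circle2pi => fourier (-k) x) := map_continuous _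
    have : ∀ P, _ := fun P => hp_int_eq hc _ (w.toJordanDecomposition.posPart.map (hpPhi P))
      (w.toJordanDecomposition.negPart.map (hpPhi P)) rfl
    simp_rw [this]
    exact (hp_map_tendsto _ hc).sub (hp_map_tendsto _ hc)

/-- Green coefficients. -/
noncomputable def hpA (M : ℕ) (k : ℤ) : ℂ := if k = 0 then 0 else 1 / (Complex.I * (k : ℂ)) ^ M

lemma hpA_summable (M : ℕ) (hM : 2 ≤ M) : Summable (fun k => ‖hpA M k‖) := by
  have h : Summable (fun k : ℤ => |1 / (k : ℝ) ^ M|) :=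
    (Real.summable_one_div_int_pow.2 (by omega)).abs
  refine Summable.of_nonneg_of_le (fun _ => norm_nonneg _) (fun k => ?_) h
  unfold hpA
  split_ifs with hk
  · simp
  · rw [norm_div, norm_pow, norm_mul, Complex.norm_I, one_mul, norm_one, abs_div, abs_pow, abs_one]
    simp

lemma hp_green_eq (M : ℕ) (x : Circle2pi) : greenC M x = ∑' k : ℤ, hpA M k * fourier k x := by
  unfold greenC hpA
  refine tsum_congr fun k => ?_
  split_ifs
  · simp
  · ring

lemma hp_norm_fourier (k : ℤ) (x : Circle2pi) : ‖(fourier k x : ℂ)‖ = 1 := by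
  rw [fourier_apply]; exact Circle.norm_coe _

lemma hp_green_cont (M : ℕ) (hM : 2 ≤ M) : Continuous (greenC M) := by
  have : greenC M = fun x => ∑' k : ℤ, hpA M k * fourier k x := funext (hp_green_eq M)
  rw [this]
  refine continuous_tsum (fun k => by fun_prop) (hpA_summable M hM) (fun k x => ?_)
  rw [norm_mul, hp_norm_fourier, mul_one]

lemma hp_fourier_sub (k : ℤ) (x t : Circle2pi) :
    (fourier k (x - t) : ℂ) = fourier k x * fourier (-k) t := by
  rw [fourier_apply, fourier_apply, fourier_apply, zsmul_sub, sub_eq_add_neg, ← neg_zsmul,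
    AddCircle.toCircle_add, Circle.coe_mul]

lemma hp_green_int (M : ℕ) (hM : 2 ≤ M) (μ : Measure Circle2pi) [IsFiniteMeasure μ]
    (x : Circle2pi) :
    HasSum (fun k : ℤ => hpA M k * fourier k x * ∫ t, fourier (-k) t ∂μ)
      (∫ t, greenC M (x - t) ∂μ) := by
  have h := hasSum_integral_of_summable_integral_norm (E := ℂ) (μ := μ)
    (F := fun (k : ℤ) (t : Circle2pi) => hpA M k * fourier k x * fourier (-k) t)
    (fun k => hp_intg (by fun_prop) _) (by
      simp only [norm_mul, hp_norm_fourier, mul_one, integral_const, smul_eq_mul]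
      exact (hpA_summable M hM).mul_left _)
  simp only [integral_const_mul] at h
  have he : ∀ t, greenC M (x - t) = ∑' k : ℤ, hpA M k * fourier k x * fourier (-k) t := by
    intro t
    rw [hp_green_eq]
    refine tsum_congr fun k => ?_
    rw [hp_fourier_sub]
    ring
  simp_rw [he]
  exact h

lemma hp_conv_hasSum (M : ℕ) (hM : 2 ≤ M) (w : SignedMeasure Circle2pi) (x : Circle2pi) :
    HasSum (fun k : ℤ => hpA M k * fourier k x * fCoeff w k)
      (sIntC w fun t => greenC M (x - t)) := by
  have h := (hp_green_int M hM w.toJordanDecomposition.posPart x).sub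
    (hp_green_int M hM w.toJordanDecomposition.negPart x)
  unfold fCoeff sIntC
  simpa only [← mul_sub] using h

lemma hp_conv_eq (M : ℕ) (hM : 2 ≤ M) (w : SignedMeasure Circle2pi) (x : Circle2pi) :
    greenConv M w x = (sIntC w fun t => greenC M (x - t)).re := by
  have hc : Continuous fun t : Circle2pi => greenC M (x - t) :=
    (hp_green_cont M hM).comp (continuous_const.sub continuous_id)
  rw [hp_re w hc]
  rfl

lemma hp_fc_le (w : SignedMeasure Circle2pi) (k : ℤ) : ‖fCoeff w k‖ ≤ tvNorm w := by
  have := hp_norm_le w (h := fun x => fourier (-k) x) (η := fun _ => 0) continuous_const 0 1 0 le_rfl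
    (by intro x; rw [hp_norm_fourier]; simp)
  rw [one_mul, zero_mul, add_zero] at this
  exact this

lemma hp_unif (M : ℕ) (hM : 2 ≤ M) (w : ℕ → SignedMeasure Circle2pi) (w0 : SignedMeasure Circle2pi)
    (B : ℝ) (hB : ∀ᶠ n in atTop, tvNorm (w n) ≤ B)
    (hk : ∀ k : ℤ, Tendsto (fun n => fCoeff (w n) k) atTop (𝓝 (fCoeff w0 k))) (a : ℕ → ℝ) (a0 : ℝ)
    (ha : ∀ᶠ n in atTop, a n = a0) :
    TendstoUniformly (fun n x => a n + greenConv M (w n) x)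
      (fun x => a0 + greenConv M w0 x) atTop := by
  have hlim : Tendsto (fun n => ∑' k : ℤ, ‖hpA M k‖ * ‖fCoeff (w n) k - fCoeff w0 k‖) atTop
      (𝓝 (∑' k : ℤ, (0 : ℝ))) := by
    refine tendsto_tsum_of_dominated_convergence (bound := fun k => ‖hpA M k‖ * (B + tvNorm w0))
      ((hpA_summable M hM).mul_right _) (fun k => ?_) ?_
    · have := ((hk k).sub_const (fCoeff w0 k)).norm.const_mul ‖hpA M k‖
      simpa using this
    · filter_upwards [hB] with n hn k
      rw [Real.norm_of_nonneg (by positivity)]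
      gcongr
      exact (norm_sub_le _ _).trans (add_le_add ((hp_fc_le _ _).trans hn) (hp_fc_le _ _))
  rw [tsum_zero] at hlim
  rw [Metric.tendstoUniformly_iff]
  intro ε hε
  filter_upwards [hlim.eventually_lt_const hε, hB, ha] with n hn hBn han x
  refine lt_of_le_of_lt ?_ hn
  rw [dist_comm, Real.dist_eq, han, add_sub_add_left_eq_sub, hp_conv_eq M hM, hp_conv_eq M hM,
    ← Complex.sub_re]
  refine (Complex.abs_re_le_norm _).trans ?_
  have hs := (hp_conv_hasSum M hM (w n) x).sub (hp_conv_hasSum M hM w0 x)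
  have hsum : Summable (fun k : ℤ => ‖hpA M k‖ * ‖fCoeff (w n) k - fCoeff w0 k‖) := by
    refine Summable.of_nonneg_of_le (fun _ => by positivity) (fun k => ?_)
      ((hpA_summable M hM).mul_right (B + tvNorm w0))
    gcongr
    exact (norm_sub_le _ _).trans (add_le_add ((hp_fc_le _ _).trans hBn) (hp_fc_le _ _))
  rw [← hs.tsum_eq]
  refine tsum_of_norm_bounded hsum.hasSum fun k => ?_
  rw [← mul_sub, norm_mul, norm_mul, hp_norm_fourier, mul_one]

end GridGreen

section Final

lemma hp_vanish (w : ℕ → SignedMeasure Circle2pi) (h : Circle2pi → ℂ) (hh : Continuous h)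
    (η : Circle2pi → ℝ) (hη : Continuous η) (lam : ℝ) (hb : ∀ x, |η x| ≤ lam)
    (hv : ∀ x, |η x| = lam → h x = 0) (B : ℝ) (hB : ∀ᶠ n in atTop, tvNorm (w n) ≤ B)
    (hg : Tendsto (fun n => lam * tvNorm (w n) - sIntR (w n) η) atTop (𝓝 0)) :
    Tendsto (fun n => sIntC (w n) h) atTop (𝓝 0) := by
  have hB0 : 0 ≤ B := by
    obtain ⟨n, hn⟩ := hB.exists
    exact (hp_tv_nonneg _).trans hn
  rw [tendsto_zero_iff_norm_tendsto_zero]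
  refine squeeze_zero' (g := fun n => ‖sIntC (w n) h‖) (Eventually.of_forall fun _ => norm_nonneg _)
    (Eventually.of_forall fun _ => le_rfl) ?_
  rw [Metric.tendsto_atTop']
  intro ε hε
  obtain ⟨C, hC, hbd⟩ := hp_bound h hh η hη lam hb hv (ε / (2 * (B + 1))) (by positivity)
  have h1 : Tendsto (fun n => C * (lam * tvNorm (w n) - sIntR (w n) η)) atTop (𝓝 0) := by
    simpa using hg.const_mul C
  have h2 := h1.eventually_lt_const (half_pos hε)
  have h3 : ∀ᶠ n in atTop, dist ‖sIntC (w n) h‖ 0 < ε := by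
    filter_upwards [hB, h2] with n hn1 hn2
    rw [Real.dist_0_eq_abs, abs_norm]
    have h4 := hp_norm_le (w n) hη lam _ C hC hbd
    have h5 : ε / (2 * (B + 1)) * tvNorm (w n) ≤ ε / 2 := by
      rw [div_mul_eq_mul_div, div_le_div_iff₀ (by positivity) (by norm_num)]
      nlinarith
    linarith
  obtain ⟨N, hN⟩ := eventually_atTop.1 h3
  exact ⟨N, fun n hn => hN n hn.le⟩

lemma hp_conv (Kc : ℕ) (S : Finset Circle2pi) (hS : S.card ≤ 2 * Kc)
    (w : ℕ → SignedMeasure Circle2pi) (w0 : SignedMeasure Circle2pi)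
    (η : Circle2pi → ℝ) (hη : Continuous η) (lam : ℝ) (hb : ∀ x, |η x| ≤ lam)
    (hv : ∀ x, |η x| = lam → x ∈ S) (B : ℝ) (hB : ∀ᶠ n in atTop, tvNorm (w n) ≤ B)
    (hg : Tendsto (fun n => lam * tvNorm (w n) - sIntR (w n) η) atTop (𝓝 0))
    (hg0 : lam * tvNorm w0 - sIntR w0 η = 0)
    (hk : ∀ k : ℤ, |k| ≤ Kc → Tendsto (fun n => fCoeff (w n) k) atTop (𝓝 (fCoeff w0 k)))
    (k : ℤ) : Tendsto (fun n => fCoeff (w n) k) atTop (𝓝 (fCoeff w0 k)) := by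
  obtain ⟨b, hbx⟩ := hp_interp Kc S hS (fun x => fourier (-k) x)
  set q : Circle2pi → ℂ := fun x =>
    ∑ j ∈ Finset.range (2 * Kc + 1), b j * fourier ((j : ℤ) - Kc) x with hq
  have hqc : Continuous q := by fun_prop
  set h : Circle2pi → ℂ := fun x => fourier (-k) x + (-1) * q x with hh
  have hhc : Continuous h := by fun_prop
  have hhv : ∀ x, |η x| = lam → h x = 0 := by
    intro x hx
    have := hbx x (hv x hx)
    simp only [hh, hq]
    rw [this]
    ring
  have t1 := hp_vanish w h hhc η hη lam hb hhv B hB hg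
  have t2 := hp_vanish (fun _ => w0) h hhc η hη lam hb hhv (tvNorm w0)
    (Eventually.of_forall fun _ => le_rfl) (by simp only [hg0]; exact tendsto_const_nhds)
  have e0 : sIntC w0 h = 0 := tendsto_nhds_unique tendsto_const_nhds t2
  have hqs : ∀ w : SignedMeasure Circle2pi, sIntC w q =
      ∑ j ∈ Finset.range (2 * Kc + 1), b j * fCoeff w (Kc - (j : ℤ)) := by
    intro w
    rw [hq, hp_sIntC_sum w _ (fun j x => b j * fourier ((j : ℤ) - Kc) x)
      (fun j _ => by fun_prop)]
    refine Finset.sum_congr rfl fun j _ => ?_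
    rw [hp_sIntC_mul]
    unfold fCoeff
    rw [neg_sub]
  have hdec : ∀ w : SignedMeasure Circle2pi, fCoeff w k = sIntC w h +
      ∑ j ∈ Finset.range (2 * Kc + 1), b j * fCoeff w (Kc - (j : ℤ)) := by
    intro w
    rw [hh, hp_sIntC_add w (by fun_prop) (by fun_prop), hp_sIntC_mul, ← hqs]
    unfold fCoeff
    ring
  simp_rw [hdec]
  rw [e0]
  refine t1.add (tendsto_finsetSum _ fun j hj => (hk _ ?_).const_mul _)
  have := Finset.mem_range.1 hj
  rw [abs_le]
  constructor <;> omega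

lemma hp_grid_zero_mean (P : ℕ) (w : SignedMeasure Circle2pi) (h : IsGridMeasure P w) :
    w Set.univ = 0 := by
  obtain ⟨c, hc, rfl⟩ := h
  simp [diracSM, hc]

lemma hp_sq_expand (y z z0 : ℂ) :
    ‖y - z‖ ^ 2 = ‖y - z0‖ ^ 2
      - 2 * (((starRingEnd ℂ) (y - z0) * z).re - ((starRingEnd ℂ) (y - z0) * z0).re)
      + ‖z - z0‖ ^ 2 := by
  simp only [← Complex.normSq_eq_norm_sq, Complex.normSq_apply, Complex.mul_re, Complex.conj_re,
    Complex.conj_im, Complex.sub_re, Complex.sub_im]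
  ring

theorem hp_main (M Kc : ℕ) (hM : 2 ≤ M) (lam : ℝ) (hlam : 0 < lam)
    (y0 : ℝ) (yr : Fin Kc → ℂ)
    (wstar : SignedMeasure Circle2pi) (astar : ℝ)
    (hzm : wstar Set.univ = 0)
    (hstar : ∀ (w : SignedMeasure Circle2pi) (a : ℝ), w Set.univ = 0 →
      quadJ M Kc y0 yr lam wstar astar ≤ quadJ M Kc y0 yr lam w a)
    (wP : ℕ → SignedMeasure Circle2pi) (aP : ℕ → ℝ)
    (hgrid : ∀ P : ℕ, 1 ≤ P → IsGridMeasure P (wP P))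
    (hPmin : ∀ P : ℕ, 1 ≤ P → ∀ (w : SignedMeasure Circle2pi) (a : ℝ), IsGridMeasure P w →
      quadJ M Kc y0 yr lam (wP P) (aP P) ≤ quadJ M Kc y0 yr lam w a) :
    TendstoUniformly (fun (P : ℕ) (x : Circle2pi) => aP P + greenConv M (wP P) x)
      (fun x => astar + greenConv M wstar x) atTop := by
  -- the constants
  have hast : astar = y0 := by
    have h := hstar wstar y0 hzm
    unfold quadJ at h
    have : (y0 - astar) ^ 2 ≤ 0 := by nlinarith
    have : y0 - astar = 0 := pow_eq_zero_iff (two_ne_zero) |>.1 (le_antisymm this (sq_nonneg _))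
    linarith
  have haP : ∀ P, 1 ≤ P → aP P = y0 := by
    intro P hP
    have h := hPmin P hP (wP P) y0 (hgrid P hP)
    unfold quadJ at h
    have : (y0 - aP P) ^ 2 ≤ 0 := by nlinarith
    have : y0 - aP P = 0 := pow_eq_zero_iff (two_ne_zero) |>.1 (le_antisymm this (sq_nonneg _))
    linarith
  subst hast
  set L : Fin Kc → ℂ := fun k => (Complex.I * ((k.1 + 1 : ℕ) : ℂ)) ^ M with hL
  have hL0 : ∀ k, L k ≠ 0 := fun k => pow_ne_zero _
    (mul_ne_zero Complex.I_ne_zero (Nat.cast_ne_zero.2 (Nat.succ_ne_zero k.1)))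
  set z : SignedMeasure Circle2pi → Fin Kc → ℂ := fun w k => fCoeff w ((k.1 : ℤ) + 1) / L k with hz
  set r : Fin Kc → ℂ := fun k => yr k - z wstar k with hr
  set A : SignedMeasure Circle2pi → ℝ := fun w => ∑ k, ((starRingEnd ℂ) (r k) * z w k).re with hA
  set D : SignedMeasure Circle2pi → ℝ := fun w => ∑ k, ‖z w k - z wstar k‖ ^ 2 with hD
  have hD0 : ∀ w, 0 ≤ D w := fun w => Finset.sum_nonneg fun _ _ => by positivity
  have hJ : ∀ w, quadJ M Kc astar yr lam w astar - quadJ M Kc astar yr lam wstar astar =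
      1 / 2 * D w - (A w - A wstar) + lam * (tvNorm w - tvNorm wstar) := by
    intro w
    have h1 : ∑ k, ‖yr k - z w k‖ ^ 2 = ∑ k, ‖yr k - z wstar k‖ ^ 2 - 2 * (A w - A wstar) + D w := by
      simp only [hA, hD]
      rw [← Finset.sum_sub_distrib, Finset.mul_sum, ← Finset.sum_sub_distrib,
        ← Finset.sum_add_distrib]
      exact Finset.sum_congr rfl fun k _ => hp_sq_expand _ _ _
    unfold quadJ
    change (1 / 2) * (_ + ∑ k, ‖yr k - z w k‖ ^ 2) + _ -
      ((1 / 2) * (_ + ∑ k, ‖yr k - z wstar k‖ ^ 2) + _) = _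
    rw [h1]
    ring
  -- linearity
  have hzlin : ∀ (w h : SignedMeasure Circle2pi) (s t : ℝ≥0) k,
      z ((s : ℝ) • w + (t : ℝ) • h) k = s * z w k + t * z h k := by
    intro w h s t k
    simp only [hz]
    unfold fCoeff
    rw [hp_lin_intC w h s t (map_continuous _)]
    ring
  have hAlin : ∀ (w h : SignedMeasure Circle2pi) (s t : ℝ≥0),
      A ((s : ℝ) • w + (t : ℝ) • h) = s * A w + t * A h := by
    intro w h s t
    simp only [hA, hzlin]
    rw [Finset.mul_sum, Finset.mul_sum, ← Finset.sum_add_distrib]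
    refine Finset.sum_congr rfl fun k _ => ?_
    simp only [Complex.mul_re, Complex.add_re, Complex.add_im, Complex.mul_im]
    have e1 : ∀ u : ℝ≥0, (((u : ℝ) : ℂ)).re = u := fun u => Complex.ofReal_re _
    have e2 : ∀ u : ℝ≥0, (((u : ℝ) : ℂ)).im = 0 := fun u => Complex.ofReal_im _
    simp only [e1, e2]
    ring
  -- variational inequality
  have hvar : ∀ h : SignedMeasure Circle2pi, h Set.univ = 0 →
      A h - A wstar ≤ lam * (tvNorm h - tvNorm wstar) := by
    intro h hh
    by_contra hcon
    push Not at hcon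
    set X := A h - A wstar - lam * (tvNorm h - tvNorm wstar) with hX
    have hXpos : 0 < X := by rw [hX]; linarith
    have hB0 := hD0 h
    set t : ℝ := X / (X + D h) with ht
    have ht0 : 0 < t := by positivity
    have ht1 : t ≤ 1 := by rw [ht, div_le_one (by positivity)]; linarith
    set tn : ℝ≥0 := ⟨t, ht0.le⟩ with htn
    set sn : ℝ≥0 := ⟨1 - t, by linarith⟩ with hsn
    have c1 : (tn : ℝ) = t := rfl
    have c2 : (sn : ℝ) = 1 - t := rfl
    have hm : ((sn : ℝ) • wstar + (tn : ℝ) • h) Set.univ = 0 := by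
      simp [hzm, hh]
    have h1 := hstar _ astar hm
    have h2 := hJ ((sn : ℝ) • wstar + (tn : ℝ) • h)
    have h3 := hAlin wstar h sn tn
    have h4 := hp_lin_tv wstar h sn tn
    have h5 : D ((sn : ℝ) • wstar + (tn : ℝ) • h) = t ^ 2 * D h := by
      simp only [hD, hzlin]
      rw [Finset.mul_sum]
      refine Finset.sum_congr rfl fun k _ => ?_
      have : ((sn : ℝ) : ℂ) * z wstar k + ((tn : ℝ) : ℂ) * z h k - z wstar k
          = (t : ℂ) * (z h k - z wstar k) := by
        rw [c1, c2]; push_cast; ring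
      rw [this, norm_mul, mul_pow, Complex.norm_real, Real.norm_eq_abs, sq_abs]
    rw [h5, h3] at h2
    rw [c1, c2] at h1 h2 h4
    have h6 : lam * (tvNorm ((1 - t) • wstar + t • h)) ≤
        lam * ((1 - t) * tvNorm wstar + t * tvNorm h) := by gcongr
    have h7 : t * X ≤ t * (t * D h / 2) := by
      rw [hX]
      nlinarith
    have h8 : X ≤ t * D h / 2 := le_of_mul_le_mul_left h7 ht0
    have h9 : t * D h ≤ X := by
      rw [ht, div_mul_eq_mul_div, div_le_iff₀ (by positivity)]
      nlinarith
    linarith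
  have hAs1 : lam * tvNorm wstar ≤ A wstar := by
    have h := hvar (((0 : ℝ≥0) : ℝ) • wstar + ((0 : ℝ≥0) : ℝ) • wstar) (by simp [hzm])
    have h2 := hp_lin_tv wstar wstar 0 0
    rw [hAlin] at h
    simp only [NNReal.coe_zero, zero_mul, add_zero] at h h2
    nlinarith
  have hAs2 : A wstar ≤ lam * tvNorm wstar := by
    have h := hvar (((1 : ℝ≥0) : ℝ) • wstar + ((1 : ℝ≥0) : ℝ) • wstar) (by simp [hzm])
    have h2 := hp_lin_tv wstar wstar 1 1
    rw [hAlin] at h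
    simp only [NNReal.coe_one, one_mul] at h h2
    nlinarith
  -- dual function
  set d : Fin Kc → ℂ := fun k => (starRingEnd ℂ) (r k) / L k with hd
  set Ψ : Circle2pi → ℂ := fun x => ∑ k : Fin Kc, d k * fourier (-((k.1 : ℤ) + 1)) x with hΨ
  have hΨc : Continuous Ψ := by fun_prop
  set ψ : Circle2pi → ℝ := fun x => (∑ k : Fin Kc, d k * fourier (-((k.1 : ℤ) + 1)) x).re with hψ
  have hψc : Continuous ψ := Complex.continuous_re.comp hΨc
  have hAΨ : ∀ w, A w = (sIntC w Ψ).re := by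
    intro w
    rw [hΨ, hp_sIntC_sum w _ (fun k x => d k * fourier (-((k.1 : ℤ) + 1)) x)
      (fun j _ => by fun_prop), Complex.re_sum]
    refine Finset.sum_congr rfl fun k _ => ?_
    rw [hp_sIntC_mul]
    simp only [hz, hd]
    unfold fCoeff
    congr 1
    ring
  obtain ⟨x1, -, hx1⟩ := (isCompact_univ (X := Circle2pi)).exists_isMaxOn ⟨0, trivial⟩
    hψc.continuousOn
  obtain ⟨x2, -, hx2⟩ := (isCompact_univ (X := Circle2pi)).exists_isMinOn ⟨0, trivial⟩
    hψc.continuousOn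
  have hosc : ψ x1 - ψ x2 ≤ 2 * lam := by
    have hm : (diracSM x1 - diracSM x2) Set.univ = 0 := by simp [diracSM]
    have h1 := hvar _ hm
    have h2 : tvNorm (diracSM x1 - diracSM x2) ≤ 2 := by
      refine (hp_tv_le _ (Measure.dirac x1) (Measure.dirac x2) rfl).trans_eq ?_
      simp
      norm_num
    have h3 : A (diracSM x1 - diracSM x2) = ψ x1 - ψ x2 := by
      rw [hAΨ]
      unfold sIntC
      rw [hp_int_eq hΨc (diracSM x1 - diracSM x2) (Measure.dirac x1) (Measure.dirac x2) rfl, integral_dirac, integral_dirac]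
      rfl
    rw [h3] at h1
    nlinarith
  set c : ℝ := (ψ x1 + ψ x2) / 2 with hc
  set η : Circle2pi → ℝ := fun x => ψ x - (ψ x1 + ψ x2) / 2 with hη
  have hηc : Continuous η := by fun_prop
  have hb : ∀ x, |η x| ≤ lam := by
    intro x
    have a1 : ψ x ≤ ψ x1 := hx1 (Set.mem_univ x)
    have a2 : ψ x2 ≤ ψ x := hx2 (Set.mem_univ x)
    rw [abs_le]
    simp only [hη]
    constructor <;> linarith
  obtain ⟨S, hS, hSv⟩ := hp_finite d ψ rfl x1 x2 lam hlam hb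
  have hAη : ∀ w : SignedMeasure Circle2pi, w Set.univ = 0 → sIntR w η = A w := by
    intro w hw
    have h1 : (sIntC w (fun x => Ψ x + (-(c : ℂ)) * fourier (-0) x)).re = sIntR w η := by
      rw [hp_re w (by fun_prop)]
      congr 1
      funext x
      simp only [neg_zero, fourier_zero, mul_one, Complex.add_re, Complex.neg_re,
        Complex.ofReal_re, hη]
      rw [← hc, sub_eq_add_neg]
    rw [← h1, hp_sIntC_add w hΨc (by fun_prop), hp_sIntC_mul, Complex.add_re, hAΨ]
    have := hp_fc_zero w hw
    unfold fCoeff at this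
    rw [this]
    simp
  -- energy convergence
  obtain ⟨v, hv1, hv2, hv3⟩ := hp_grid wstar hzm
  have hzv : ∀ k, Tendsto (fun P => z (v P) k) atTop (𝓝 (z wstar k)) := fun k =>
    (hv3 _).div_const _
  have hDv : Tendsto (fun P => D (v P)) atTop (𝓝 0) := by
    have : Tendsto (fun P => D (v P)) atTop (𝓝 (D wstar)) :=
      tendsto_finsetSum _ fun k _ => (((hzv k).sub_const _).norm.pow 2)
    have h0 : D wstar = 0 := by simp [hD]
    rwa [h0] at this
  have hAv : Tendsto (fun P => A (v P)) atTop (𝓝 (A wstar)) :=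
    tendsto_finsetSum _ fun k _ => (Complex.continuous_re.tendsto _).comp ((hzv k).const_mul _)
  set e : ℕ → ℝ := fun P => 1 / 2 * D (v P) - (A (v P) - A wstar) with he
  have het : Tendsto e atTop (𝓝 0) := by
    have := (hDv.const_mul (1 / 2)).sub (hAv.sub_const (A wstar))
    rw [mul_zero, sub_self, sub_zero] at this
    exact this
  have hkey : ∀ P, 1 ≤ P → 1 / 2 * D (wP P) + (lam * tvNorm (wP P) - A (wP P)) ≤ e P := by
    intro P hP
    have h1 := hPmin P hP (v P) astar (hv1 P hP)
    rw [haP P hP] at h1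
    have h2 := hJ (wP P)
    have h3 := hJ (v P)
    have h4 := mul_le_mul_of_nonneg_left (hv2 P) hlam.le
    simp only [he]
    linarith
  have hAle : ∀ P, 1 ≤ P → A (wP P) ≤ lam * tvNorm (wP P) := by
    intro P hP
    have := hvar (wP P) (hp_grid_zero_mean P _ (hgrid P hP))
    linarith
  have hgap : Tendsto (fun P => lam * tvNorm (wP P) - sIntR (wP P) η) atTop (𝓝 0) := by
    refine squeeze_zero' ?_ ?_ het
    · filter_upwards [eventually_ge_atTop 1] with P hP
      rw [hAη _ (hp_grid_zero_mean P _ (hgrid P hP))]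
      linarith [hAle P hP]
    · filter_upwards [eventually_ge_atTop 1] with P hP
      rw [hAη _ (hp_grid_zero_mean P _ (hgrid P hP))]
      linarith [hkey P hP, hD0 (wP P)]
  have hDP : Tendsto (fun P => D (wP P)) atTop (𝓝 0) := by
    have : Tendsto (fun P => 2 * e P) atTop (𝓝 0) := by simpa using het.const_mul 2
    refine squeeze_zero' (Eventually.of_forall fun P => hD0 _) ?_ this
    filter_upwards [eventually_ge_atTop 1] with P hP
    linarith [hkey P hP, hAle P hP]
  have hzP : ∀ k, Tendsto (fun P => z (wP P) k) atTop (𝓝 (z wstar k)) := by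
    intro k
    rw [tendsto_iff_norm_sub_tendsto_zero]
    have h1 : Tendsto (fun P => ‖z (wP P) k - z wstar k‖ ^ 2) atTop (𝓝 0) :=
      squeeze_zero (fun _ => by positivity) (fun P =>
        Finset.single_le_sum (f := fun k => ‖z (wP P) k - z wstar k‖ ^ 2)
          (fun _ _ => by positivity) (Finset.mem_univ k)) hDP
    have h2 := h1.sqrt
    simpa using h2
  have hpos : ∀ k : ℕ, 1 ≤ k → k ≤ Kc →
      Tendsto (fun P => fCoeff (wP P) (k : ℤ)) atTop (𝓝 (fCoeff wstar (k : ℤ))) := by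
    intro k h1 h2
    have h3 := (hzP ⟨k - 1, by omega⟩).mul_const (L ⟨k - 1, by omega⟩)
    have h4 : ((k - 1 : ℕ) : ℤ) + 1 = k := by omega
    simp only [hz, div_mul_cancel₀ _ (hL0 _), h4] at h3
    exact h3
  have hlow : ∀ k : ℤ, |k| ≤ Kc →
      Tendsto (fun P => fCoeff (wP P) k) atTop (𝓝 (fCoeff wstar k)) := by
    intro k hk
    rcases lt_trichotomy k 0 with h | h | h
    · obtain ⟨n, hn⟩ := Int.eq_ofNat_of_zero_le (show 0 ≤ -k by omega)
      have hk' : k = -(n : ℤ) := by omega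
      rw [hk'] at hk ⊢
      rw [abs_neg, Nat.abs_cast] at hk
      simp only [hp_fc_neg]
      exact (Complex.continuous_conj.tendsto _).comp (hpos n (by omega) (by omega))
    · subst h
      rw [hp_fc_zero _ hzm]
      refine tendsto_const_nhds.congr' ?_
      filter_upwards [eventually_ge_atTop 1] with P hP
      rw [hp_fc_zero _ (hp_grid_zero_mean P _ (hgrid P hP))]
    · obtain ⟨n, hn⟩ := Int.eq_ofNat_of_zero_le h.le
      subst hn
      rw [Nat.abs_cast] at hk
      exact hpos n (by omega) (by omega)
  have hBd : ∀ᶠ P in atTop, tvNorm (wP P) ≤ quadJ M Kc astar yr lam 0 0 / lam := by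
    filter_upwards [eventually_ge_atTop 1] with P hP
    have h1 := hPmin P hP 0 0 ⟨fun _ => 0, by simp, by simp⟩
    rw [le_div_iff₀ hlam]
    refine le_trans ?_ h1
    unfold quadJ
    have : 0 ≤ (1 / 2 : ℝ) * ((astar - aP P) ^ 2 + ∑ k : Fin Kc,
        ‖yr k - fCoeff (wP P) ((k.1 : ℤ) + 1) / (Complex.I * ((k.1 + 1 : ℕ) : ℂ)) ^ M‖ ^ 2) := by
      positivity
    linarith
  refine hp_unif M hM wP wstar _ hBd ?_ aP astar ?_
  · exact hp_conv Kc S hS wP wstar η hηc lam hb hSv _ hBd hgap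
      (by rw [hAη _ hzm]; linarith) hlow
  · filter_upwards [eventually_ge_atTop 1] with P hP using haP P hP

end Final

/-- The reconstructions `f_{w_P,a_P} = a_P + g_M ⊛ w_P` of the
grid-discretized problems converge uniformly on `𝕋` to the reconstruction
`f_{w*,a*} = a* + g_M ⊛ w*` from the unique solution of the continuous problem. -/
theorem stmt4 (M Kc : ℕ) (hM : 2 ≤ M) (lam : ℝ) (hlam : 0 < lam)
    (y0 : ℝ) (yr : Fin Kc → ℂ)
    (wstar : SignedMeasure Circle2pi) (astar : ℝ)
    (hzm : wstar Set.univ = 0)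
    (hstar : ∀ (w : SignedMeasure Circle2pi) (a : ℝ), w Set.univ = 0 →
      quadJ M Kc y0 yr lam wstar astar ≤ quadJ M Kc y0 yr lam w a)
    (wP : ℕ → SignedMeasure Circle2pi) (aP : ℕ → ℝ)
    (hgrid : ∀ P : ℕ, 1 ≤ P → IsGridMeasure P (wP P))
    (hPmin : ∀ P : ℕ, 1 ≤ P → ∀ (w : SignedMeasure Circle2pi) (a : ℝ), IsGridMeasure P w →
      quadJ M Kc y0 yr lam (wP P) (aP P) ≤ quadJ M Kc y0 yr lam w a) :
    TendstoUniformly (fun (P : ℕ) (x : Circle2pi) => aP P + greenConv M (wP P) x)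
      (fun x => astar + greenConv M wstar x) atTop := by
  exact hp_main M Kc hM lam hlam y0 yr wstar astar hzm hstar wP aP hgrid hPmin
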